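/- Let R = (6,5,4,3,3,2,2,1,1) and S = (7,3,3,2,2,1,1,1,1,1,1,1,1,1,1). Then there is no matrix A ∈ A(R,S) such that ρ_t(A) = ρ̃_t(R,S) for all t = 1,…,6. (In particular, the conjecture that every nonempty class A(R,S) contains a matrix realizing all minimum t-term ranks simultaneously is false.) -/

import Mathlib

open Finset

/-- `A` is a `(0,1)`-matrix: every entry is `0` or `1`. -/
def IsZeroOne {m n : ℕ} (A : Matrix (Fin m) (Fin n) ℕ) : Prop :=
  ∀ i j, A i j = 0 ∨ A i j = 1

/-- The class `𝒜(R,S)` of `(0,1)`-matrices with row sum vector `R` and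
column sum vector `S`. -/
def ARS {m n : ℕ} (R : Fin m → ℕ) (S : Fin n → ℕ) :
    Set (Matrix (Fin m) (Fin n) ℕ) :=
  {A | IsZeroOne A ∧ (∀ i, ∑ j, A i j = R i) ∧ (∀ j, ∑ i, A i j = S j)}

/-- `R` and `S` are partitions of the same weight. -/
def IsPartitionPair {m n : ℕ} (R : Fin m → ℕ) (S : Fin n → ℕ) : Prop :=
  Antitone R ∧ (∀ i, 0 < R i) ∧ Antitone S ∧ (∀ j, 0 < S j) ∧
    ∑ i, R i = ∑ j, S j

/-- The rows `E` and the columns `F` cover all the `1`'s of `A`. -/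
def Covers {m n : ℕ} (A : Matrix (Fin m) (Fin n) ℕ)
    (E : Finset (Fin m)) (F : Finset (Fin n)) : Prop :=
  ∀ i j, A i j = 1 → i ∈ E ∨ j ∈ F

/-- The `t`-term rank of `A`: the maximum number of `1`'s of `A` with at most
one `1` in each column and at most `t` `1`'s in each row. -/
def tTermRank {m n : ℕ} (t : ℕ) (A : Matrix (Fin m) (Fin n) ℕ) : ℕ :=
  Finset.sup ((Finset.univ : Finset (Fin m × Fin n)).powerset.filter fun P =>
      (∀ p ∈ P, A p.1 p.2 = 1) ∧
      (∀ j : Fin n, (P.filter fun p => p.2 = j).card ≤ 1) ∧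
      (∀ i : Fin m, (P.filter fun p => p.1 = i).card ≤ t))
    Finset.card

/-- The minimum `t`-term rank over the class `𝒜(R,S)`. -/
noncomputable def minTermRank {m n : ℕ} (t : ℕ) (R : Fin m → ℕ)
    (S : Fin n → ℕ) : ℕ :=
  sInf {r : ℕ | ∃ A ∈ ARS R S, tTermRank t A = r}

/-- The structure matrix `t_{k,l}` associated with `R` and `S`
(`R`, `S` being 1-indexed in the paper, here 0-indexed):
`t_{k,l} = k·l − ∑_{j=1}^{l} S_j + ∑_{i=k+1}^{m} R_i`. -/
def structMat {m n : ℕ} (R : Fin m → ℕ) (S : Fin n → ℕ) (k l : ℕ) : ℤ :=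
  (k : ℤ) * l - ∑ j ∈ Finset.univ.filter (fun j : Fin n => (j : ℕ) < l), (S j : ℤ)
    + ∑ i ∈ Finset.univ.filter (fun i : Fin m => k ≤ (i : ℕ)), (R i : ℤ)

/-- `φ_{k,l} = min { t_{i1,l+j2} + t_{k+i2,j1} + (k−i1)(l−j1) }` over all
`0 ≤ i1 ≤ k ≤ k+i2 ≤ m` and `0 ≤ j1 ≤ l ≤ l+j2 ≤ n`. -/
noncomputable def phi {m n : ℕ} (R : Fin m → ℕ) (S : Fin n → ℕ) (k l : ℕ) : ℤ :=
  sInf {v : ℤ | ∃ i1 i2 j1 j2 : ℕ,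
    i1 ≤ k ∧ k + i2 ≤ m ∧ j1 ≤ l ∧ l + j2 ≤ n ∧
    v = structMat R S i1 (l + j2) + structMat R S (k + i2) j1
        + ((k : ℤ) - i1) * ((l : ℤ) - j1)}

/-- `ψ_{a,b;c,d}` as in the paper, the minimum being taken over all
`0 ≤ i1 ≤ a ≤ a+i2 ≤ b ≤ b+i3 ≤ m` and `0 ≤ j1 ≤ c ≤ c+j2 ≤ d ≤ d+j3 ≤ n`. -/
noncomputable def psi {m n : ℕ} (R : Fin m → ℕ) (S : Fin n → ℕ)
    (a b c d : ℕ) : ℤ :=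
  sInf {v : ℤ | ∃ i1 i2 i3 j1 j2 j3 : ℕ,
    i1 ≤ a ∧ a + i2 ≤ b ∧ b + i3 ≤ m ∧
    j1 ≤ c ∧ c + j2 ≤ d ∧ d + j3 ≤ n ∧
    v = structMat R S i1 (d + j3) + structMat R S (a + i2) (c + j2)
        + structMat R S (b + i3) j1
        + ((a : ℤ) - i1) * ((d : ℤ) - (c : ℤ) - j2)
        + ((b : ℤ) - (a : ℤ) - i2) * ((c : ℤ) - j1)
        + ((a : ℤ) - i1) * ((c : ℤ) - j1)}

/-- The row sum vector of the counterexample. -/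
def R₀ : Fin 9 → ℕ := ![6, 5, 4, 3, 3, 2, 2, 1, 1]

/-- The column sum vector of the counterexample. -/
def S₀ : Fin 15 → ℕ := ![7, 3, 3, 2, 2, 1, 1, 1, 1, 1, 1, 1, 1, 1, 1]

section General

variable {m n : ℕ} {A : Matrix (Fin m) (Fin n) ℕ}

theorem tTermRank_le_of_covers {E : Finset (Fin m)} {F : Finset (Fin n)}
    (h : Covers A E F) (t : ℕ) : tTermRank t A ≤ t * #E + #F := by
  refine Finset.sup_le fun P hP => ?_
  obtain ⟨hA, hcol, hrow⟩ := (Finset.mem_filter.1 hP).2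
  have hsub : P ⊆ (E.biUnion fun i => P.filter fun p => p.1 = i) ∪
      (F.biUnion fun j => P.filter fun p => p.2 = j) := by
    intro p hp
    rcases h p.1 p.2 (hA p hp) with hE | hF
    · exact mem_union_left _ (mem_biUnion.2 ⟨p.1, hE, mem_filter.2 ⟨hp, rfl⟩⟩)
    · exact mem_union_right _ (mem_biUnion.2 ⟨p.2, hF, mem_filter.2 ⟨hp, rfl⟩⟩)
  have hE : #(E.biUnion fun i => P.filter fun p => p.1 = i) ≤ #E * t :=
    card_biUnion_le_card_mul _ _ _ fun i _ => hrow i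
  have hF : #(F.biUnion fun j => P.filter fun p => p.2 = j) ≤ #F * 1 :=
    card_biUnion_le_card_mul _ _ _ fun j _ => hcol j
  calc #P ≤ _ := card_le_card hsub
    _ ≤ _ := card_union_le _ _
    _ ≤ t * #E + #F := by rw [mul_comm t]; omega

/-- The nontrivial half of the König-type duality for `t`-term ranks. -/
theorem exists_covers_le_tTermRank (t : ℕ) (A : Matrix (Fin m) (Fin n) ℕ) :
    ∃ E F, Covers A E F ∧ t * #E + #F ≤ tTermRank t A := by
  by_contra! hlt
  have hn : tTermRank t A < n := by
    simpa using hlt ∅ univ fun _ _ _ => Or.inr (mem_univ _)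
  set d := n - (tTermRank t A + 1) with hd
  let slots : Fin n → Finset ((Fin m × Fin t) ⊕ Fin d) := fun j =>
    ((univ.filter fun i => A i j = 1) ×ˢ univ).disjSum univ
  have hall : ∀ X : Finset (Fin n), #X ≤ #(X.biUnion slots) := by
    intro X
    rcases X.eq_empty_or_nonempty with rfl | ⟨j₀, hj₀⟩
    · simp
    have hcov := hlt (X.biUnion fun j => univ.filter fun i => A i j = 1) Xᶜ (by
      intro i j hij
      by_cases hj : j ∈ X
      · exact Or.inl (mem_biUnion.2 ⟨j, hj, by simpa using hij⟩)
      · exact Or.inr (by simpa using hj))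
    have hsub : ((X.biUnion fun j => univ.filter fun i => A i j = 1) ×ˢ
        (univ : Finset (Fin t))).disjSum (univ : Finset (Fin d)) ⊆ X.biUnion slots := by
      rintro (⟨i, k⟩ | k) hx
      · simpa [slots] using hx
      · exact mem_biUnion.2 ⟨j₀, hj₀, by simp [slots]⟩
    have hcard := card_le_card hsub
    rw [card_disjSum, card_product, card_univ, card_univ, Fintype.card_fin,
      Fintype.card_fin, mul_comm] at hcard
    rw [card_compl, Fintype.card_fin] at hcov
    have hX : #X ≤ n := by simpa using card_le_univ X
    omega
  obtain ⟨f, hf, hmem⟩ := (all_card_le_biUnion_card_iff_exists_injective slots).1 hall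
  let P : Finset (Fin m × Fin n) := univ.filter fun p => ∃ k, f p.2 = Sum.inl (p.1, k)
  have hP : #P ≤ tTermRank t A := by
    refine Finset.le_sup (f := Finset.card) (mem_filter.2 ⟨by simp, ?_, ?_, ?_⟩)
    · intro p hp
      obtain ⟨k, hk⟩ := (mem_filter.1 hp).2
      have := hmem p.2
      rw [hk] at this
      simpa [slots] using this
    · intro j
      refine card_le_one.2 ?_
      rintro ⟨i, j₁⟩ h₁ ⟨i', j₂⟩ h₂
      simp only [P, mem_filter, mem_univ, true_and] at h₁ h₂
      obtain ⟨⟨k, hk⟩, rfl⟩ := h₁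
      obtain ⟨⟨k', hk'⟩, rfl⟩ := h₂
      rw [hk] at hk'
      simp at hk'
      simp [hk'.1]
    · intro i
      have hsub : ((P.filter fun p => p.1 = i).image fun p => f p.2) ⊆
          (univ : Finset (Fin t)).image fun k => Sum.inl (i, k) := by
        intro x hx
        obtain ⟨p, hp, rfl⟩ := mem_image.1 hx
        simp only [P, mem_filter, mem_univ, true_and] at hp
        obtain ⟨⟨k, hk⟩, rfl⟩ := hp
        exact mem_image.2 ⟨k, mem_univ _, hk.symm⟩
      have hinj : Set.InjOn (fun p : Fin m × Fin n => f p.2)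
          (P.filter fun p => p.1 = i) := by
        rintro ⟨i₁, j₁⟩ h₁ ⟨i₂, j₂⟩ h₂ h
        replace h₁ := (mem_filter.1 (mem_coe.1 h₁)).2
        replace h₂ := (mem_filter.1 (mem_coe.1 h₂)).2
        exact Prod.ext (h₁.trans h₂.symm) (hf h)
      rw [← card_image_of_injOn hinj]
      exact (card_le_card hsub).trans (card_image_le.trans (by simp))
  have hcols : (univ : Finset (Fin n)) ⊆
      P.image Prod.snd ∪ univ.filter fun j => ∃ k, f j = Sum.inr k := by
    intro j _
    rcases hj : f j with ⟨i, k⟩ | k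
    · exact mem_union_left _ (mem_image.2 ⟨(i, j), by simp [P, hj], rfl⟩)
    · exact mem_union_right _ (by simp [hj])
  have hinr : #(univ.filter fun j => ∃ k, f j = Sum.inr k) ≤ d := by
    rw [← card_image_of_injective _ hf]
    refine (card_le_card (t := (univ : Finset (Fin d)).image Sum.inr) ?_).trans
      (card_image_le.trans (by simp))
    intro x hx
    obtain ⟨j, hj, rfl⟩ := mem_image.1 hx
    obtain ⟨k, hk⟩ := (mem_filter.1 hj).2
    exact mem_image.2 ⟨k, mem_univ _, hk.symm⟩
  have h₁ := card_le_card hcols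
  have h₂ := card_union_le (P.image Prod.snd) (univ.filter fun j => ∃ k, f j = Sum.inr k)
  have h₃ : #(P.image Prod.snd) ≤ #P := card_image_le
  rw [card_univ, Fintype.card_fin] at h₁
  omega

theorem exists_covers_of_minTermRank {R : Fin m → ℕ} {S : Fin n → ℕ} {t : ℕ}
    (hA : tTermRank t A = minTermRank t R S) {B : Matrix (Fin m) (Fin n) ℕ}
    (hB : B ∈ ARS R S) {E : Finset (Fin m)} {F : Finset (Fin n)} (h : Covers B E F) :
    ∃ E' F', Covers A E' F' ∧ t * #E' + #F' ≤ t * #E + #F := by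
  obtain ⟨E', F', hc, hle⟩ := exists_covers_le_tTermRank t A
  refine ⟨E', F', hc, hle.trans ?_⟩
  rw [hA]
  have hmin : minTermRank t R S ≤ tTermRank t B := Nat.sInf_le ⟨B, hB, rfl⟩
  exact hmin.trans (tTermRank_le_of_covers h t)

/-- A sum over a set of prescribed size is bounded through any threshold `c`. -/
theorem sum_le_mul_card_add_sum_tsub (g : Fin n → ℕ) (X : Finset (Fin n)) (c : ℕ) :
    ∑ j ∈ X, g j ≤ c * #X + ∑ j, (g j - c) := by
  calc ∑ j ∈ X, g j ≤ ∑ j ∈ X, (c + (g j - c)) := sum_le_sum fun j _ => by omega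
    _ = c * #X + ∑ j ∈ X, (g j - c) := by simp [sum_add_distrib, mul_comm]
    _ ≤ _ := by gcongr; exact subset_univ X

variable {R : Fin m → ℕ} {S : Fin n → ℕ}

theorem sum_compl_eq_of_covers (hA : A ∈ ARS R S) {E : Finset (Fin m)}
    {F : Finset (Fin n)} (h : Covers A E F) :
    ∑ i ∈ Eᶜ, R i = ∑ j ∈ F, ∑ i ∈ Eᶜ, A i j := by
  rw [sum_comm]
  refine sum_congr rfl fun i hi => ?_
  rw [← hA.2.1 i]
  refine (sum_subset (subset_univ F) fun j _ hj => ?_).symm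
  exact (hA.1 i j).resolve_right fun h1 => (h i j h1).elim (mem_compl.1 hi) hj

theorem sum_rows_le_of_covers (hA : A ∈ ARS R S) {E : Finset (Fin m)}
    {F : Finset (Fin n)} (h : Covers A E F) :
    ∑ i, R i ≤ ∑ i ∈ E, R i + ∑ j ∈ F, min (S j) (m - #E) := by
  rw [← sum_add_sum_compl E R, sum_compl_eq_of_covers hA h]
  gcongr with j
  refine le_min ?_ ?_
  · rw [← hA.2.2 j]
    exact sum_le_sum_of_subset (subset_univ _)
  · calc ∑ i ∈ Eᶜ, A i j ≤ ∑ i ∈ Eᶜ, 1 :=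
          sum_le_sum fun i _ => by rcases hA.1 i j with h | h <;> omega
      _ = m - #E := by simp [card_compl]

/-- If the cover `(E', F')` arises from the cover `(E, F)` by dropping one row and adding
columns, then the rows of `E'` and the columns of `F` carry all but `|F' \ F|` of the `1`'s. -/
theorem sum_rows_le_of_covers_of_covers (hA : A ∈ ARS R S) {E E' : Finset (Fin m)}
    {F F' : Finset (Fin n)} (h : Covers A E F) (h' : Covers A E' F') {r : Fin m}
    (hr : r ∉ E') (hE : E = insert r E') (hF : F ⊆ F') :
    ∑ i, R i ≤ ∑ i ∈ E', R i + ∑ j ∈ F, S j + #(F' \ F) := by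
  have hcompl : E'ᶜ = insert r Eᶜ := by
    ext i
    by_cases hi : i = r <;> simp [hE, hi, hr]
  rw [← sum_add_sum_compl E' R, sum_compl_eq_of_covers hA h', add_assoc,
    ← sum_sdiff hF, add_comm (∑ j ∈ F' \ F, _)]
  gcongr with j
  · rw [← hA.2.2 j]
    exact sum_le_sum_of_subset (subset_univ _)
  · calc ∑ j ∈ F' \ F, ∑ i ∈ E'ᶜ, A i j ≤ ∑ j ∈ F' \ F, 1 := ?_
      _ = #(F' \ F) := by simp
    refine sum_le_sum fun j hj => ?_
    rw [hcompl, sum_insert (by simp [hE])]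
    have hzero : ∑ i ∈ Eᶜ, A i j = 0 := sum_eq_zero fun i hi =>
      (hA.1 i j).resolve_right fun h1 =>
        (h i j h1).elim (mem_compl.1 hi) (mem_sdiff.1 hj).2
    rcases hA.1 r j with h | h <;> omega

theorem Covers.union_inter {E E' : Finset (Fin m)} {F F' : Finset (Fin n)}
    (h : Covers A E F) (h' : Covers A E' F') : Covers A (E ∪ E') (F ∩ F') := by
  intro i j hij
  have := h i j hij
  have := h' i j hij
  simp only [mem_union, mem_inter]
  tauto

theorem Covers.inter_union {E E' : Finset (Fin m)} {F F' : Finset (Fin n)}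
    (h : Covers A E F) (h' : Covers A E' F') : Covers A (E ∩ E') (F ∪ F') := by
  intro i j hij
  have := h i j hij
  have := h' i j hij
  simp only [mem_union, mem_inter]
  tauto

end General

/-- A matrix in `𝒜(R₀,S₀)` whose `1`'s are covered by three rows and three columns. -/
def blockThreeThree : Matrix (Fin 9) (Fin 15) ℕ :=
  !![0, 0, 0, 1, 1, 1, 0, 1, 1, 0, 0, 0, 0, 1, 0;
     0, 0, 0, 1, 1, 0, 0, 0, 0, 1, 1, 0, 0, 0, 1;
     1, 0, 0, 0, 0, 0, 1, 0, 0, 0, 0, 1, 1, 0, 0;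
     1, 1, 1, 0, 0, 0, 0, 0, 0, 0, 0, 0, 0, 0, 0;
     1, 1, 1, 0, 0, 0, 0, 0, 0, 0, 0, 0, 0, 0, 0;
     1, 1, 0, 0, 0, 0, 0, 0, 0, 0, 0, 0, 0, 0, 0;
     1, 0, 1, 0, 0, 0, 0, 0, 0, 0, 0, 0, 0, 0, 0;
     1, 0, 0, 0, 0, 0, 0, 0, 0, 0, 0, 0, 0, 0, 0;
     1, 0, 0, 0, 0, 0, 0, 0, 0, 0, 0, 0, 0, 0, 0]

/-- A matrix in `𝒜(R₀,S₀)` whose `1`'s are covered by two rows and five columns. -/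
def blockTwoFive : Matrix (Fin 9) (Fin 15) ℕ :=
  !![0, 0, 0, 0, 0, 1, 1, 1, 1, 0, 0, 0, 1, 1, 0;
     0, 0, 0, 0, 1, 0, 0, 0, 0, 1, 1, 1, 0, 0, 1;
     1, 1, 1, 1, 0, 0, 0, 0, 0, 0, 0, 0, 0, 0, 0;
     1, 1, 1, 0, 0, 0, 0, 0, 0, 0, 0, 0, 0, 0, 0;
     1, 1, 1, 0, 0, 0, 0, 0, 0, 0, 0, 0, 0, 0, 0;
     1, 0, 0, 1, 0, 0, 0, 0, 0, 0, 0, 0, 0, 0, 0;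
     1, 0, 0, 0, 1, 0, 0, 0, 0, 0, 0, 0, 0, 0, 0;
     1, 0, 0, 0, 0, 0, 0, 0, 0, 0, 0, 0, 0, 0, 0;
     1, 0, 0, 0, 0, 0, 0, 0, 0, 0, 0, 0, 0, 0, 0]

theorem blockThreeThree_mem : blockThreeThree ∈ ARS R₀ S₀ := by
  have h : ∀ p : Fin 9 × Fin 15, blockThreeThree p.1 p.2 = 0 ∨ blockThreeThree p.1 p.2 = 1 := by
    decide +kernel
  refine ⟨fun i j => h (i, j), ?_, ?_⟩
  · decide +kernel
  · decide +kernel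

theorem blockTwoFive_mem : blockTwoFive ∈ ARS R₀ S₀ := by
  have h : ∀ p : Fin 9 × Fin 15, blockTwoFive p.1 p.2 = 0 ∨ blockTwoFive p.1 p.2 = 1 := by
    decide +kernel
  refine ⟨fun i j => h (i, j), ?_, ?_⟩
  · decide +kernel
  · decide +kernel

theorem covers_blockThreeThree : Covers blockThreeThree {0, 1, 2} {0, 1, 2} := by
  have h : ∀ p : Fin 9 × Fin 15, blockThreeThree p.1 p.2 = 1 →
      p.1 ∈ ({0, 1, 2} : Finset (Fin 9)) ∨ p.2 ∈ ({0, 1, 2} : Finset (Fin 15)) := by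
    decide +kernel
  exact fun i j => h (i, j)

theorem covers_blockTwoFive : Covers blockTwoFive {0, 1} {0, 1, 2, 3, 4} := by
  have h : ∀ p : Fin 9 × Fin 15, blockTwoFive p.1 p.2 = 1 →
      p.1 ∈ ({0, 1} : Finset (Fin 9)) ∨ p.2 ∈ ({0, 1, 2, 3, 4} : Finset (Fin 15)) := by
    decide +kernel
  exact fun i j => h (i, j)

section Counterexample

variable {A : Matrix (Fin 9) (Fin 15) ℕ} {E : Finset (Fin 9)} {F : Finset (Fin 15)}

theorem sum_R₀_le (E : Finset (Fin 9)) :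
    ∑ i ∈ E, R₀ i ≤ 6 * #E ∧ ∑ i ∈ E, R₀ i ≤ 5 * #E + 1 ∧
    ∑ i ∈ E, R₀ i ≤ 4 * #E + 3 ∧ ∑ i ∈ E, R₀ i ≤ 3 * #E + 6 ∧
    ∑ i ∈ E, R₀ i ≤ 2 * #E + 11 := by
  have h := sum_le_mul_card_add_sum_tsub R₀ E
  exact ⟨h 6, h 5, h 4, h 3, h 2⟩

theorem sum_S₀_le (F : Finset (Fin 15)) :
    ∑ j ∈ F, S₀ j ≤ 3 * #F + 4 ∧ ∑ j ∈ F, S₀ j ≤ 2 * #F + 7 ∧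
    ∑ j ∈ F, S₀ j ≤ #F + 12 := by
  have h := sum_le_mul_card_add_sum_tsub S₀ F
  exact ⟨h 3, h 2, (h 1).trans (by rw [one_mul]; exact le_rfl)⟩

theorem sum_R₀ : ∑ i, R₀ i = 27 := by decide +kernel

theorem le_sum_add_sum_of_covers (hA : A ∈ ARS R₀ S₀) (h : Covers A E F) :
    27 ≤ ∑ i ∈ E, R₀ i + ∑ j ∈ F, S₀ j := by
  rw [← sum_R₀]
  refine (sum_rows_le_of_covers hA h).trans ?_
  gcongr
  exact min_le_left _ _

theorem le_sum_add_of_covers (hA : A ∈ ARS R₀ S₀) (h : Covers A E F) (hE : 4 ≤ #E) :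
    27 ≤ ∑ i ∈ E, R₀ i + (3 * #F + 2) := by
  rw [← sum_R₀]
  refine (sum_rows_le_of_covers hA h).trans ?_
  gcongr
  calc ∑ j ∈ F, min (S₀ j) (9 - #E) ≤ ∑ j ∈ F, min (S₀ j) 5 := by gcongr; omega
    _ ≤ _ := sum_le_mul_card_add_sum_tsub _ F 3

theorem card_of_covers_of_card_add_card_le (hA : A ∈ ARS R₀ S₀) (h : Covers A E F)
    (hle : #E + #F ≤ 6) : #E = 3 ∧ #F = 3 := by
  have h₁ := sum_R₀_le E
  have h₂ := sum_S₀_le F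
  have h₃ := le_sum_add_sum_of_covers hA h
  have h₄ := le_sum_add_of_covers hA h
  by_cases hE : 4 ≤ #E
  · have := h₄ hE
    omega
  · omega

theorem card_of_covers_of_three_mul_card_add_card_le (hA : A ∈ ARS R₀ S₀)
    (h : Covers A E F) (hle : 3 * #E + #F ≤ 11) : #E = 2 ∧ #F = 5 := by
  have h₁ := sum_R₀_le E
  have h₂ := sum_S₀_le F
  have h₃ := le_sum_add_sum_of_covers hA h
  omega

theorem not_covers_chain (hA : A ∈ ARS R₀ S₀) {E' : Finset (Fin 9)}
    {F' : Finset (Fin 15)} (h : Covers A E F) (h' : Covers A E' F') (hE : E' ⊆ E)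
    (hF : F ⊆ F') (hle : #E + #F ≤ 6) (hle' : 3 * #E' + #F' ≤ 11) : False := by
  obtain ⟨hE₃, hF₃⟩ := card_of_covers_of_card_add_card_le hA h hle
  obtain ⟨hE₂, hF₅⟩ := card_of_covers_of_three_mul_card_add_card_le hA h' hle'
  obtain ⟨r, hr⟩ := card_eq_one.1 (show #(E \ E') = 1 by rw [card_sdiff_of_subset hE]; omega)
  have hr' : r ∉ E' := (mem_sdiff.1 (hr ▸ mem_singleton_self r)).2
  have hins : E = insert r E' := by
    rw [insert_eq, ← hr, sdiff_union_of_subset hE]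
  have hsum := sum_rows_le_of_covers_of_covers hA h h' hr' hins hF
  rw [sum_R₀, card_sdiff_of_subset hF] at hsum
  have := sum_R₀_le E'
  have := sum_S₀_le F
  omega

end Counterexample

/-- Counterexample to the conjecture: for `R = (6,5,4,3,3,2,2,1,1)` and
`S = (7,3,3,2,2,1,1,1,1,1,1,1,1,1,1)` no matrix in `𝒜(R,S)` realizes all the
minimum `t`-term ranks for `t = 1,…,6`. -/
theorem no_matrix_realizes_all_min_tTermRanks :
    ¬ ∃ A ∈ ARS R₀ S₀, ∀ t : ℕ, 1 ≤ t → t ≤ 6 →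
        tTermRank t A = minTermRank t R₀ S₀ := by
  rintro ⟨A, hA, hmin⟩
  obtain ⟨E, F, h, hle⟩ := exists_covers_of_minTermRank (hmin 1 (by norm_num) (by norm_num))
    blockThreeThree_mem covers_blockThreeThree
  obtain ⟨E', F', h', hle'⟩ := exists_covers_of_minTermRank
    (hmin 3 (by norm_num) (by norm_num)) blockTwoFive_mem covers_blockTwoFive
  replace hle : #E + #F ≤ 6 := by rw [one_mul] at hle; exact hle
  replace hle' : 3 * #E' + #F' ≤ 11 := hle'
  have hu := h.union_inter h'
  have hi := h.inter_union h'
  have h₁ := card_union_add_card_inter E E'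
  have h₂ := card_union_add_card_inter F F'
  have h₃ := card_of_covers_of_card_add_card_le hA hu
  have h₄ := card_of_covers_of_three_mul_card_add_card_le hA hi
  have h₅ : #E ≤ #(E ∪ E') := card_le_card subset_union_left
  have h₆ := card_of_covers_of_card_add_card_le hA h hle
  have h₇ := card_of_covers_of_three_mul_card_add_card_le hA h' hle'
  refine not_covers_chain hA hu hi (inter_subset_left.trans subset_union_left)
    (inter_subset_left.trans subset_union_left) ?_ ?_ <;> omega
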